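/- arXiv:1909.08262 — 2 statements merged into one kernel-verified Lean document; each statement's English description precedes it below -/
import Mathlib

section
/- Let K and L be nonempty compact convex sets in ℝ². Then (vol(K + L) − vol(K) − vol(L))² ≥ 4 · vol(K) · vol(L). (This is the n = 2 case of the Alexandrov–Fenchel type inequality of Theorem 7.1, since for n = 2 one has MV(K, L) = vol(K+L) − vol(K) − vol(L) and MV(K, K) = 2·vol(K).) -/
open scoped Pointwise
open MeasureTheory

/-- Lebesgue area of a subset of ℝ², as a real number. -/
noncomputable def vol (A : Set (Fin 2 → ℝ)) : ℝ := (volume A).toReal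

theorem bm_one_compact (A B : Set ℝ) (hA : IsCompact A) (hB : IsCompact B)
    (hAn : A.Nonempty) (hBn : B.Nonempty) :
    volume A + volume B ≤ volume (A + B) := by
  obtain ⟨M, hM, hMA⟩ := hA.exists_isGreatest hAn
  obtain ⟨m, hm, hmB⟩ := hB.exists_isLeast hBn
  have h1 : ((fun x => m + x) '' A) ∪ ((fun x => M + x) '' B) ⊆ A + B := by
    rintro x (⟨a, ha, rfl⟩ | ⟨b, hb, rfl⟩)
    · exact ⟨a, ha, m, hm, add_comm _ _⟩
    · exact ⟨M, hM, b, hb, rfl⟩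
  have hBm : MeasurableSet ((fun x => M + x) '' B) :=
    (hB.image (by fun_prop)).measurableSet
  have hd : AEDisjoint volume ((fun x => m + x) '' A) ((fun x => M + x) '' B) := by
    refine measure_mono_null (t := {m + M}) ?_ (by simp)
    rintro x ⟨⟨a, ha, rfl⟩, ⟨b, hb, hx⟩⟩
    have h2 := hMA ha
    have h3 := hmB hb
    simp only [Set.mem_singleton_iff] at *
    linarith
  calc volume A + volume B
      = volume ((fun x => m + x) '' A) + volume ((fun x => M + x) '' B) := by
        simp
    _ = volume (((fun x => m + x) '' A) ∪ ((fun x => M + x) '' B)) :=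
        (measure_union₀ hBm.nullMeasurableSet hd).symm
    _ ≤ _ := measure_mono h1

theorem bm_one (A B : Set ℝ) (hA : MeasurableSet A) (hB : MeasurableSet B)
    (hAn : A.Nonempty) (hBn : B.Nonempty) :
    volume A + volume B ≤ volume (A + B) := by
  obtain ⟨a, ha⟩ := hAn
  obtain ⟨b, hb⟩ := hBn
  rw [hA.measure_eq_iSup_isCompact, hB.measure_eq_iSup_isCompact]
  simp only [iSup_and']
  have key : ∀ C ⊆ A, IsCompact C → ∀ D ⊆ B, IsCompact D →
      volume C + volume D ≤ volume (A + B) := by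
    intro C hC hCc D hD hDc
    calc volume C + volume D ≤ volume (insert a C) + volume (insert b D) := by
          gcongr <;> simp
      _ ≤ volume (insert a C + insert b D) :=
          bm_one_compact _ _ (hCc.insert a) (hDc.insert b) (by simp) (by simp)
      _ ≤ _ := measure_mono (Set.add_subset_add (Set.insert_subset ha hC)
          (Set.insert_subset hb hD))
  have e : ∀ (S : Set ℝ), (⨆ (K) (_ : K ⊆ S ∧ IsCompact K), volume K)
      = ⨆ K : {K : Set ℝ // K ⊆ S ∧ IsCompact K}, volume K.1 := fun S => by
    rw [iSup_subtype]
  rw [e, e]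
  haveI : Nonempty {K : Set ℝ // K ⊆ A ∧ IsCompact K} := ⟨⟨∅, by simp⟩⟩
  haveI : Nonempty {K : Set ℝ // K ⊆ B ∧ IsCompact K} := ⟨⟨∅, by simp⟩⟩
  rw [ENNReal.iSup_add]
  refine iSup_le fun C => ?_
  rw [ENNReal.add_iSup]
  exact iSup_le fun D => key _ C.2.1 C.2.2 _ D.2.1 D.2.2

noncomputable def slc (A : Set (ℝ × ℝ)) (x : ℝ) : ℝ := (volume (Prod.mk x ⁻¹' A)).toReal

theorem slc_compact {A : Set (ℝ × ℝ)} (hA : IsCompact A) (x : ℝ) :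
    IsCompact (Prod.mk x ⁻¹' A) :=
  (hA.image continuous_snd).of_isClosed_subset (hA.isClosed.preimage (by fun_prop))
    fun y hy => ⟨(x, y), hy, rfl⟩

theorem slc_meas {A : Set (ℝ × ℝ)} (hA : IsCompact A) : Measurable (slc A) :=
  (measurable_measure_prodMk_left hA.measurableSet).ennreal_toReal

theorem slc_int {A : Set (ℝ × ℝ)} (hA : IsCompact A) (c : ℝ) (hc : 0 < c) :
    ∫⁻ x, ENNReal.ofReal (slc A x / c) = volume A / ENNReal.ofReal c := by
  rw [Measure.volume_eq_prod, Measure.prod_apply hA.measurableSet, div_eq_mul_inv,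
    ← lintegral_mul_const _ (measurable_measure_prodMk_left hA.measurableSet)]
  congr 1; ext x
  rw [ENNReal.ofReal_div_of_pos hc, slc,
    ENNReal.ofReal_toReal (slc_compact hA x).measure_lt_top.ne, div_eq_mul_inv]

theorem slc_bdd {A : Set (ℝ × ℝ)} (hA : IsCompact A) : BddAbove (Set.range (slc A)) := by
  refine ⟨(volume (Prod.snd '' A)).toReal, ?_⟩
  rintro _ ⟨x, rfl⟩
  exact ENNReal.toReal_mono (hA.image continuous_snd).measure_lt_top.ne
    (measure_mono fun y hy => ⟨(x, y), hy, rfl⟩)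

theorem slc_pos {A : Set (ℝ × ℝ)} (hA : IsCompact A) (h : volume A ≠ 0) :
    0 < sSup (Set.range (slc A)) := by
  by_contra hn
  apply h
  have := slc_int hA 1 one_pos
  have h0 : ∀ x, ENNReal.ofReal (slc A x / 1) = 0 := fun x => by
    rw [ENNReal.ofReal_eq_zero, div_one]
    exact (le_csSup (slc_bdd hA) ⟨x, rfl⟩).trans (not_lt.1 hn)
  simp only [h0] at this
  simpa using this.symm

theorem slc_add {A B : Set (ℝ × ℝ)} (hA : IsCompact A) (hB : IsCompact B) (x y : ℝ)
    (hx : 0 < slc A x) (hy : 0 < slc B y) : slc A x + slc B y ≤ slc (A + B) (x + y) := by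
  have ne : ∀ {A : Set (ℝ × ℝ)} {x : ℝ}, 0 < slc A x → (Prod.mk x ⁻¹' A).Nonempty := by
    intro A x h
    by_contra hn
    rw [Set.not_nonempty_iff_eq_empty] at hn
    simp [slc, hn] at h
  have h := bm_one_compact _ _ (slc_compact hA x) (slc_compact hB y) (ne hx) (ne hy)
  unfold slc
  rw [← ENNReal.toReal_add (slc_compact hA x).measure_lt_top.ne
    (slc_compact hB y).measure_lt_top.ne]
  refine ENNReal.toReal_mono (slc_compact (hA.add hB) _).measure_lt_top.ne
    (h.trans (measure_mono ?_))
  rintro _ ⟨u, hu, v, hv, rfl⟩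
  exact ⟨(x, u), hu, (y, v), hv, rfl⟩

theorem bm_two {A B : Set (ℝ × ℝ)} (hA : IsCompact A) (hB : IsCompact B)
    (hA0 : volume A ≠ 0) (hB0 : volume B ≠ 0) : ∃ a b : ℝ, 0 < a ∧ 0 < b ∧
    volume A / ENNReal.ofReal a + volume B / ENNReal.ofReal b
      ≤ volume (A + B) / ENNReal.ofReal (a + b) := by
  have ha := slc_pos hA hA0
  have hb := slc_pos hB hB0
  refine ⟨_, _, ha, hb, ?_⟩
  have hba := fun x => le_csSup (slc_bdd hA) ⟨x, rfl⟩
  have hbb := fun x => le_csSup (slc_bdd hB) ⟨x, rfl⟩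
  have hla := fun t => exists_lt_of_lt_csSup (b := t) (Set.range_nonempty (slc A))
  have hlb := fun t => exists_lt_of_lt_csSup (b := t) (Set.range_nonempty (slc B))
  generalize sSup (Set.range (slc A)) = a at *
  generalize sSup (Set.range (slc B)) = b at *
  have hab : 0 < a + b := by positivity
  have hAB := hA.add hB
  rw [← slc_int hA _ ha, ← slc_int hB _ hb, ← slc_int hAB _ hab]
  have lc : ∀ (S : Set (ℝ × ℝ)) (hS : IsCompact S) (c : ℝ) (hc : 0 < c),
      ∫⁻ x, ENNReal.ofReal (slc S x / c)
        = ∫⁻ t in Set.Ioi 0, volume {x | t < slc S x / c} := by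
    intro S hS c hc
    refine lintegral_eq_lintegral_meas_lt _ (Filter.Eventually.of_forall fun x => ?_)
      ((slc_meas hS).div_const c).aemeasurable
    exact div_nonneg ENNReal.toReal_nonneg hc.le
  rw [lc A hA a ha, lc B hB b hb, lc _ hAB _ hab, ← lintegral_add_left]
  · refine setLIntegral_mono' measurableSet_Ioi fun t ht => ?_
    have ht : 0 < t := ht
    by_cases h1 : t < 1
    · have mA : MeasurableSet {x | t < slc A x / a} :=
        measurableSet_lt measurable_const ((slc_meas hA).div_const _)
      have mB : MeasurableSet {x | t < slc B x / b} :=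
        measurableSet_lt measurable_const ((slc_meas hB).div_const _)
      refine (bm_one _ _ mA mB ?_ ?_).trans (measure_mono ?_)
      · obtain ⟨_, ⟨x, rfl⟩, hx⟩ := hla (t * a) (by nlinarith)
        exact ⟨x, (lt_div_iff₀ ha).2 hx⟩
      · obtain ⟨_, ⟨x, rfl⟩, hx⟩ := hlb (t * b) (by nlinarith)
        exact ⟨x, (lt_div_iff₀ hb).2 hx⟩
      · rintro _ ⟨x, hx, y, hy, rfl⟩
        have hx := (lt_div_iff₀ ha).1 hx
        have hy := (lt_div_iff₀ hb).1 hy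
        refine (lt_div_iff₀ hab).2 (lt_of_lt_of_le ?_
          (slc_add hA hB x y ((by positivity : 0 < t * a).trans hx)
            ((by positivity : 0 < t * b).trans hy)))
        linarith
    · have eA : {x | t < slc A x / a} = ∅ := by
        ext x
        simp only [Set.mem_ofPred_eq, Set.mem_empty_iff_false, iff_false, not_lt]
        exact ((div_le_one ha).2 (hba x)).trans (not_lt.1 h1)
      have eB : {x | t < slc B x / b} = ∅ := by
        ext x
        simp only [Set.mem_ofPred_eq, Set.mem_empty_iff_false, iff_false, not_lt]
        exact ((div_le_one hb).2 (hbb x)).trans (not_lt.1 h1)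
      simp [eA, eB]
  · exact Antitone.measurable fun s t hst => measure_mono fun x hx => lt_of_le_of_lt hst hx

theorem vol_transfer (K : Set (Fin 2 → ℝ)) :
    volume (MeasurableEquiv.finTwoArrow (α := ℝ) '' K) = volume K := by
  have h := (volume_preserving_finTwoArrow ℝ).measure_preimage_equiv
    (MeasurableEquiv.finTwoArrow (α := ℝ) '' K)
  rw [Set.preimage_image_eq _ (MeasurableEquiv.injective _)] at h
  exact h.symm

/-- The `n = 2` Alexandrov–Fenchel type inequality: for nonempty compact convex
sets `K, L ⊆ ℝ²`, `(vol(K + L) − vol(K) − vol(L))² ≥ 4 · vol(K) · vol(L)`,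
where `K + L` is the Minkowski sum. -/
theorem alexandrov_fenchel_dim_two (K L : Set (Fin 2 → ℝ))
    (hKne : K.Nonempty) (hKc : IsCompact K) (hKcv : Convex ℝ K)
    (hLne : L.Nonempty) (hLc : IsCompact L) (hLcv : Convex ℝ L) :
    (vol (K + L) - vol K - vol L) ^ 2 ≥ 4 * vol K * vol L := by
  by_cases hK0 : volume K = 0
  · simp only [vol, hK0]; simp; positivity
  by_cases hL0 : volume L = 0
  · simp only [vol, hL0]; simp; positivity
  have hcont : Continuous (MeasurableEquiv.finTwoArrow (α := ℝ)) := by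
    change Continuous fun f : Fin 2 → ℝ => (f 0, f 1)
    fun_prop
  have hsum : MeasurableEquiv.finTwoArrow (α := ℝ) '' (K + L)
      = MeasurableEquiv.finTwoArrow (α := ℝ) '' K + MeasurableEquiv.finTwoArrow (α := ℝ) '' L := by
    ext z
    constructor
    · rintro ⟨_, ⟨x, hx, y, hy, rfl⟩, rfl⟩
      exact ⟨_, ⟨x, hx, rfl⟩, _, ⟨y, hy, rfl⟩, rfl⟩
    · rintro ⟨_, ⟨x, hx, rfl⟩, _, ⟨y, hy, rfl⟩, rfl⟩
      exact ⟨_, ⟨x, hx, y, hy, rfl⟩, rfl⟩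
  obtain ⟨a, b, ha, hb, h⟩ := bm_two (hKc.image hcont) (hLc.image hcont)
    (by rwa [vol_transfer]) (by rwa [vol_transfer])
  rw [← hsum, vol_transfer, vol_transfer, vol_transfer] at h
  have hab : 0 < a + b := by positivity
  have fK := hKc.measure_lt_top (μ := volume).ne
  have fL := hLc.measure_lt_top (μ := volume).ne
  have fS := (hKc.add hLc).measure_lt_top (μ := volume).ne
  have nz : ∀ {c : ℝ}, 0 < c → ENNReal.ofReal c ≠ 0 := fun hc => (ENNReal.ofReal_pos.2 hc).ne'
  have h' := ENNReal.toReal_mono (ENNReal.div_ne_top fS (nz hab)) h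
  rw [ENNReal.toReal_add (ENNReal.div_ne_top fK (nz ha)) (ENNReal.div_ne_top fL (nz hb)),
    ENNReal.toReal_div, ENNReal.toReal_div, ENNReal.toReal_div, ENNReal.toReal_ofReal ha.le,
    ENNReal.toReal_ofReal hb.le, ENNReal.toReal_ofReal hab.le] at h'
  change vol K / a + vol L / b ≤ vol (K + L) / (a + b) at h'
  have pK : 0 ≤ vol K := ENNReal.toReal_nonneg
  have pL : 0 ≤ vol L := ENNReal.toReal_nonneg
  generalize vol (K + L) = s at *
  obtain ⟨u, hu⟩ : ∃ u, u = vol K / a := ⟨_, rfl⟩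
  obtain ⟨v, hv⟩ : ∃ v, v = vol L / b := ⟨_, rfl⟩
  have hu0 : 0 ≤ u := hu ▸ div_nonneg pK ha.le
  have hv0 : 0 ≤ v := hv ▸ div_nonneg pL hb.le
  rw [← hu, ← hv, le_div_iff₀ hab] at h'
  have eK : vol K = u * a := by rw [hu]; field_simp
  have eL : vol L = v * b := by rw [hv]; field_simp
  rw [eK, eL]
  have h1 : u * b + v * a ≤ s - u * a - v * b := by nlinarith
  have h2 : 0 ≤ u * b + v * a := by positivity
  have h3 := pow_le_pow_left₀ h2 h1 2
  nlinarith [sq_nonneg (u * b - v * a)]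
end

section
/- (Hodge index theorem for n = 2.) Let K and L be nonempty compact convex sets in ℝ². If vol(K) > 0 and vol(K + L) = vol(K) + vol(L), then vol(L) = 0. (In the paper's language: if deg(k²) > 0 and deg(k·ℓ) = 0 then deg(ℓ²) = 0, where k = log[K], ℓ = log[L] in the convex-set algebra, using that deg(k·ℓ) = MV(K,L) = vol(K+L) − vol(K) − vol(L) and deg(ℓ²) = 2·vol(L).) -/
open scoped Pointwise
open MeasureTheory

theorem hodge_aux_nonempty (K : Set (Fin 2 → ℝ)) (hKcv : Convex ℝ K)
    (h : 0 < vol K) : (interior K).Nonempty := by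
  by_contra hne
  rw [Set.not_nonempty_iff_eq_empty] at hne
  have h1 : volume (frontier K) = 0 := hKcv.addHaar_frontier volume
  have h2 : volume K = 0 := by
    refine measure_mono_null ?_ h1
    intro x hx
    refine ⟨subset_closure hx, ?_⟩
    rw [hne]; exact fun h => h
  simp [vol, h2] at h

theorem hodge_aux_ball (K : Set (Fin 2 → ℝ)) (a : Fin 2 → ℝ) (ha : a ∈ interior K) :
    ∃ ε > 0, ∀ x y : ℝ, |x| < ε → |y| < ε → ![a 0 + x, a 1 + y] ∈ K := by
  obtain ⟨ε, hε, hb⟩ := Metric.isOpen_iff.1 isOpen_interior a ha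
  refine ⟨ε, hε, fun x y hx hy => interior_subset (hb ?_)⟩
  rw [Metric.mem_ball, dist_pi_lt_iff hε]
  intro i
  fin_cases i <;> simpa [Real.dist_eq]

/-- Hodge index theorem for `n = 2`: if `K, L ⊆ ℝ²` are nonempty compact convex sets
with `vol(K) > 0` and `vol(K + L) = vol(K) + vol(L)` (i.e. the mixed volume
`MV(K,L) = vol(K+L) − vol(K) − vol(L)` vanishes), then `vol(L) = 0`. -/
theorem hodge_index_dim_two (K L : Set (Fin 2 → ℝ))
    (hKne : K.Nonempty) (hKc : IsCompact K) (hKcv : Convex ℝ K)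
    (hLne : L.Nonempty) (hLc : IsCompact L) (hLcv : Convex ℝ L)
    (hKpos : 0 < vol K) (hmix : vol (K + L) = vol K + vol L) :
    vol L = 0 := by
  by_contra hL0
  have hLpos : 0 < vol L := lt_of_le_of_ne ENNReal.toReal_nonneg (Ne.symm hL0)
  obtain ⟨a, ha⟩ := hodge_aux_nonempty K hKcv hKpos
  obtain ⟨b, hb⟩ := hodge_aux_nonempty L hLcv hLpos
  obtain ⟨p, hpK, hp⟩ := hKc.exists_isMaxOn hKne (continuous_apply (0 : Fin 2)).continuousOn
  obtain ⟨q, hqL, hq⟩ := hLc.exists_isMinOn hLne (continuous_apply (0 : Fin 2)).continuousOn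
  have hKLc : IsCompact (K + L) := hKc.add hLc
  have hK'c : IsCompact (q +ᵥ K) := hKc.vadd q
  have hL'c : IsCompact (p +ᵥ L) := hLc.vadd p
  have hsub : (q +ᵥ K) ∪ (p +ᵥ L) ⊆ K + L := by
    rintro x (⟨k, hk, rfl⟩ | ⟨l, hl, rfl⟩)
    · exact ⟨k, hk, q, hqL, add_comm _ _⟩
    · exact ⟨p, hpK, l, hl, rfl⟩
  have hdisj : AEDisjoint volume (q +ᵥ K) (p +ᵥ L) := by
    have : volume {f : Fin 2 → ℝ | f 0 = p 0 + q 0} = 0 :=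
      Measure.pi_hyperplane (fun _ : Fin 2 => (volume : Measure ℝ)) 0 (p 0 + q 0)
    refine measure_mono_null ?_ this
    rintro x ⟨⟨k, hk, rfl⟩, ⟨l, hl, h⟩⟩
    have h1 : k 0 ≤ p 0 := hp hk
    have h2 : q 0 ≤ l 0 := hq hl
    have h3 : p 0 + l 0 = q 0 + k 0 := congrFun h 0
    change q 0 + k 0 = p 0 + q 0
    linarith
  have hvolU : volume ((q +ᵥ K) ∪ (p +ᵥ L)) = volume K + volume L := by
    rw [measure_union₀ hL'c.measurableSet.nullMeasurableSet hdisj, measure_vadd, measure_vadd]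
  have hvol : volume (K + L) = volume K + volume L := by
    unfold vol at hmix
    rw [← ENNReal.toReal_add hKc.measure_lt_top.ne hLc.measure_lt_top.ne] at hmix
    exact (ENNReal.toReal_eq_toReal_iff' hKLc.measure_lt_top.ne
      (ENNReal.add_ne_top.2 ⟨hKc.measure_lt_top.ne, hLc.measure_lt_top.ne⟩)).1 hmix
  have hUc : IsCompact ((q +ᵥ K) ∪ (p +ᵥ L)) := hK'c.union hL'c
  have hdiff : volume ((K + L) \ ((q +ᵥ K) ∪ (p +ᵥ L))) = 0 := by
    rw [measure_sdiff hsub hUc.measurableSet.nullMeasurableSet hUc.measure_lt_top.ne,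
      hvolU, hvol, tsub_self]
  have hint : interior (K + L) ⊆ (q +ᵥ K) ∪ (p +ᵥ L) := by
    have ho : IsOpen (interior (K + L) \ ((q +ᵥ K) ∪ (p +ᵥ L))) :=
      isOpen_interior.sdiff hUc.isClosed
    have h0 := measure_mono_null (Set.sdiff_subset_sdiff_left interior_subset) hdiff
    rw [ho.measure_eq_zero_iff volume] at h0
    exact Set.diff_eq_empty.1 h0
  have hne : (interior (K + L)).Nonempty := by
    apply hodge_aux_nonempty _ (hKcv.add hLcv)
    rw [hmix]; positivity
  have hall : K + L ⊆ (q +ᵥ K) ∪ (p +ᵥ L) := by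
    refine subset_closure.trans ?_
    rw [← (hKcv.add hLcv).closure_interior_eq_closure_of_nonempty_interior hne]
    exact closure_minimal hint hUc.isClosed
  -- the separating functional
  obtain ⟨ε, hε, hKb⟩ := hodge_aux_ball K a ha
  obtain ⟨δ, hδ, hLb⟩ := hodge_aux_ball L b hb
  have hbq : q 0 < b 0 := by
    have h1 : q 0 ≤ b 0 + -(δ / 2) :=
      hq (hLb (-(δ / 2)) 0 (by rw [abs_neg, abs_of_pos (by linarith)]; linarith) (by simpa))
    linarith
  have hD : ∃ a' ∈ K, (a' 1 - p 1) * (b 0 - q 0) + (b 1 - q 1) * (p 0 - a' 0) ≠ 0 := by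
    by_cases h : (a 1 - p 1) * (b 0 - q 0) + (b 1 - q 1) * (p 0 - a 0) = 0
    · refine ⟨_, hKb 0 (ε / 2) (by simpa) (by rw [abs_of_pos (by linarith)]; linarith), ?_⟩
      have : 0 < ε / 2 * (b 0 - q 0) := mul_pos (by linarith) (by linarith)
      simp only [Matrix.cons_val_zero, Matrix.cons_val_one]
      intro h'
      nlinarith
    · exact ⟨a, interior_subset ha, h⟩
  obtain ⟨a', ha', hD⟩ := hD
  obtain ⟨s, t, h1, h2⟩ : ∃ s t : ℝ, s * q 0 + t * q 1 < s * b 0 + t * b 1 ∧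
      s * p 0 + t * p 1 < s * a' 0 + t * a' 1 := by
    have := sq_pos_of_ne_zero hD
    set D := (a' 1 - p 1) * (b 0 - q 0) + (b 1 - q 1) * (p 0 - a' 0) with hDd
    refine ⟨D * ((a' 1 - p 1) - (b 1 - q 1)), D * ((p 0 - a' 0) + (b 0 - q 0)), ?_, ?_⟩
    · rw [← sub_pos]; refine lt_of_lt_of_eq this ?_; rw [hDd]; ring
    · rw [← sub_pos]; refine lt_of_lt_of_eq this ?_; rw [hDd]; ring
  have hu : Continuous (fun x : Fin 2 → ℝ => s * x 0 + t * x 1) := by fun_prop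
  obtain ⟨k, hkK, hk⟩ := hKc.exists_isMaxOn hKne hu.continuousOn
  obtain ⟨l, hlL, hl⟩ := hLc.exists_isMaxOn hLne hu.continuousOn
  have e1 : s * a' 0 + t * a' 1 ≤ s * k 0 + t * k 1 := hk ha'
  have e2 : s * b 0 + t * b 1 ≤ s * l 0 + t * l 1 := hl (interior_subset hb)
  rcases hall ⟨k, hkK, l, hlL, rfl⟩ with ⟨x, hx, h⟩ | ⟨x, hx, h⟩
  · have e3 : s * x 0 + t * x 1 ≤ s * k 0 + t * k 1 := hk hx
    have g0 : q 0 + x 0 = k 0 + l 0 := congrFun h 0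
    have g1 : q 1 + x 1 = k 1 + l 1 := congrFun h 1
    have := congrArg (s * ·) g0
    have := congrArg (t * ·) g1
    simp only [mul_add] at *
    linarith
  · have e3 : s * x 0 + t * x 1 ≤ s * l 0 + t * l 1 := hl hx
    have g0 : p 0 + x 0 = k 0 + l 0 := congrFun h 0
    have g1 : p 1 + x 1 = k 1 + l 1 := congrFun h 1
    have := congrArg (s * ·) g0
    have := congrArg (t * ·) g1
    simp only [mul_add] at *
    linarith
end
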